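/- arXiv:2309.03446 — 7 statements merged into one kernel-verified Lean document; each statement's English description precedes it below -/
import Mathlib

section
/- Assume the maximal class setup. Then the core G_X of G in X is nontrivial. -/
open Subgroup

/-- An element of order `2 ^ k` in a core-free subgroup `H` has a regular orbit on `X ⧸ H`
that misses the trivial coset, so `2 ^ k` is less than the index of `H`. -/
lemma two_pow_lt_index_of_normalCore_eq_bot {X : Type*} [Group X] [Finite X]
    (H : Subgroup X) (hH : H.normalCore = ⊥) {z : X} (hz : z ∈ H) {k : ℕ} (hk : 0 < k)
    (hord : orderOf z = 2 ^ k) : 2 ^ k < H.index := by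
  obtain ⟨j, rfl⟩ : ∃ j, k = j + 1 := ⟨k - 1, by omega⟩
  have h_inv : z ^ 2 ^ j ≠ 1 := by
    intro h
    have h1 := orderOf_dvd_of_pow_eq_one h
    rw [hord, Nat.pow_dvd_pow_iff_le_right (by norm_num)] at h1
    omega
  obtain ⟨x, hx⟩ : ∃ x : X ⧸ H, z ^ 2 ^ j • x ≠ x := by
    by_contra! h
    refine h_inv ?_
    rw [← Subgroup.mem_bot, ← hH, Subgroup.normalCore_eq_ker, MonoidHom.mem_ker]
    ext x
    exact h x
  have h_per : MulAction.period z x = 2 ^ (j + 1) := by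
    obtain ⟨l, hl, h⟩ := (Nat.dvd_prime_pow Nat.prime_two).1
      (hord ▸ MulAction.period_dvd_orderOf z x)
    rcases hl.eq_or_lt with rfl | hl
    · exact h
    · refine absurd (MulAction.pow_smul_eq_iff_period_dvd.2 ?_) hx
      rw [h]
      exact pow_dvd_pow 2 (by omega)
  have h_orbit : (MulAction.orbit (zpowers z) x).ncard = 2 ^ (j + 1) := by
    rw [← h_per, MulAction.period_eq_minimalPeriod, ← Nat.card_coe_set_eq]
    exact (Nat.card_congr (MulAction.orbitZPowersEquiv z x)).trans (Nat.card_zmod _)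
  have h_fix (w : X) (hw : w ∈ H) : w • ((1 : X) : X ⧸ H) = ((1 : X) : X ⧸ H) := by
    rw [MulAction.Quotient.smul_coe, smul_eq_mul, mul_one, QuotientGroup.eq]
    simpa using hw
  have h_miss : ((1 : X) : X ⧸ H) ∉ MulAction.orbit (zpowers z) x := by
    rintro ⟨⟨w, hw⟩, h⟩
    have h1 : w • x = ((1 : X) : X ⧸ H) := h
    have h2 : x = ((1 : X) : X ⧸ H) := by
      rw [← h_fix w⁻¹ (H.inv_mem ((zpowers_le.2 hz) hw)), ← h1, inv_smul_smul]
    exact hx (h2 ▸ h_fix _ (H.pow_mem hz _))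
  rw [← h_orbit, Subgroup.index, ← Set.ncard_univ]
  exact Set.ncard_lt_ncard ((Set.ssubset_univ_iff).2 fun h => h_miss (h ▸ Set.mem_univ _))

/-- maximal class setup: the core of `G` in `X` is nontrivial. -/
theorem core_ne_bot_of_maximal_class_setup
    {X : Type*} [Group X] [Finite X] (hX2 : IsPGroup 2 X)
    (n m : ℕ) (hn : 5 ≤ n)
    (a b c : X) (G C : Subgroup X)
    (hG : G = Subgroup.closure {a, b})
    (hC : C = Subgroup.zpowers c)
    (hGcard : Nat.card G = 2 ^ n)
    (hCcard : Nat.card C = 2 ^ m)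
    (ha : orderOf a = 2 ^ (n - 1))
    (hrel : (b ^ 2 = 1 ∧ b⁻¹ * a * b = a⁻¹) ∨
            (b ^ 2 = a ^ 2 ^ (n - 2) ∧ b⁻¹ * a * b = a⁻¹) ∨
            (b ^ 2 = 1 ∧ b⁻¹ * a * b = a ^ (2 ^ (n - 2) - 1)))
    (hfact : ∀ x : X, ∃ g ∈ G, ∃ y ∈ C, x = g * y)
    (hdisj : G ⊓ C = ⊥)
    (hcore : C.normalCore = ⊥) :
    G.normalCore ≠ ⊥ := by
  intro h_bot
  have h_compl : IsComplement' G C := by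
    refine isComplement'_of_disjoint_and_mul_eq_univ (disjoint_iff.2 hdisj) ?_
    refine Set.eq_univ_of_forall fun x => ?_
    obtain ⟨g, hg, y, hy, rfl⟩ := hfact x
    exact Set.mul_mem_mul hg hy
  have ha_mem : a ∈ G := hG ▸ subset_closure (by simp)
  have h1 := two_pow_lt_index_of_normalCore_eq_bot G h_bot ha_mem (by omega) ha
  rw [h_compl.symm.index_eq_card, hCcard, Nat.pow_lt_pow_iff_right (by norm_num)] at h1
  have hc_mem : c ∈ C := hC ▸ mem_zpowers c
  have hc_ord : orderOf c = 2 ^ m := by rw [← hCcard, hC, Nat.card_zpowers]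
  have h2 := two_pow_lt_index_of_normalCore_eq_bot C hcore hc_mem (by omega) hc_ord
  rw [h_compl.index_eq_card, hGcard, Nat.pow_lt_pow_iff_right (by norm_num)] at h2
  omega
end

section
/- Assume the maximal class setup. If the core G_X of G in X is a proper subgroup of ⟨a⟩ and |G_X| ≥ 4, then the set ⟨a⟩⟨c⟩ = {a^i c^j} is a proper subgroup of X. -/
open Subgroup Pointwise

/-- In a cyclic `2`-group `⟨a⟩` of order `2 ^ (k + 2)`, the only elements of order `4` are
`a ^ 2 ^ k` and its inverse. -/
theorem eq_or_eq_inv_of_mem_zpowers_of_orderOf_eq_four {X : Type*} [Group X] {a w : X} {k : ℕ}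
    (ha : orderOf a = 2 ^ (k + 2)) (hw : w ∈ zpowers a) (h4 : orderOf w = 4) :
    w = a ^ 2 ^ k ∨ w = (a ^ 2 ^ k)⁻¹ := by
  obtain ⟨i, rfl⟩ := mem_zpowers_iff.mp hw
  have hw4 : a ^ (i * 4) = 1 := by
    rw [zpow_mul, show (4 : ℤ) = ((4 : ℕ) : ℤ) from rfl, zpow_natCast, ← h4, pow_orderOf_eq_one]
  rw [← orderOf_dvd_iff_zpow_eq_one, ha] at hw4
  obtain ⟨j, hj⟩ := hw4
  have hi : i = 2 ^ k * j := by push_cast [pow_add] at hj; linarith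
  have hz : (a ^ 2 ^ k) ^ 4 = 1 := by
    rw [← pow_mul, ← pow_orderOf_eq_one a, ha, pow_add]; rfl
  have hwz : a ^ i = (a ^ 2 ^ k) ^ j := by
    rw [hi, zpow_mul]; congr 1; exact_mod_cast zpow_natCast a (2 ^ k)
  rw [hwz] at h4 ⊢
  generalize a ^ 2 ^ k = z at hz h4
  have hz' : ∀ q : ℤ, z ^ (4 * q) = 1 := fun q => by
    rw [zpow_mul, show (4 : ℤ) = ((4 : ℕ) : ℤ) from rfl, zpow_natCast, hz, one_zpow]
  rcases Int.even_or_odd' j with ⟨q, rfl | rfl⟩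
  · have : (z ^ (2 * q)) ^ 2 = 1 := by
      rw [← zpow_natCast, ← zpow_mul, ← hz' q]; congr 1; push_cast; ring
    have := Nat.le_of_dvd two_pos (orderOf_dvd_of_pow_eq_one this)
    omega
  · rcases Int.even_or_odd' q with ⟨p, rfl | rfl⟩
    · left
      rw [zpow_add, ← mul_assoc, show (2 * 2 : ℤ) = 4 by rfl, hz', one_mul, zpow_one]
    · right
      rw [show 2 * (2 * p + 1) + 1 = 4 * (p + 1) + (-1) by ring, zpow_add, hz', one_mul,
        zpow_neg_one]

/-- A subgroup of order at least `4` of a cyclic group `⟨a⟩` of order `2 ^ (k + 2)` contains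
`a ^ 2 ^ k`. -/
theorem pow_two_pow_mem_of_le_zpowers {X : Type*} [Group X] {a : X} {k : ℕ}
    (ha : orderOf a = 2 ^ (k + 2)) {N : Subgroup X} (hN : N ≤ zpowers a)
    (h4 : 4 ≤ Nat.card N) : a ^ 2 ^ k ∈ N := by
  obtain ⟨g, rfl⟩ : ∃ g, zpowers g = N := by
    rw [← Subgroup.isCyclic_iff_exists_zpowers_eq_top]
    exact isCyclic_of_le hN
  have hdvd : orderOf g ∣ 2 ^ (k + 2) := ha ▸ orderOf_dvd_of_mem_zpowers (hN (mem_zpowers g))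
  obtain ⟨r, -, hr⟩ := (Nat.dvd_prime_pow Nat.prime_two).mp hdvd
  rw [Nat.card_zpowers, hr] at h4
  have h2r : 2 ≤ r := (Nat.pow_le_pow_iff_right (a := 2) (by norm_num)).mp h4
  obtain ⟨s, rfl⟩ := Nat.exists_eq_add_of_le' h2r
  have hg : g ^ 2 ^ s ∈ zpowers g := pow_mem (mem_zpowers g) _
  have ho : orderOf (g ^ 2 ^ s) = 4 := by
    rw [orderOf_pow_of_dvd (by positivity) (hr ▸ pow_dvd_pow 2 (by omega)), hr,
      Nat.pow_div (by omega) (by norm_num)]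
    simp
  rcases eq_or_eq_inv_of_mem_zpowers_of_orderOf_eq_four ha (hN hg) ho with h | h
  · exact h ▸ hg
  · exact inv_inv (a ^ 2 ^ k) ▸ inv_mem (h ▸ hg)

/-- If `X = GC` and `A ≤ G` has index two in `G`, then a subgroup containing `A` and `C` but not
all of `G` is the product set `AC`. -/
theorem coe_eq_mul_of_relIndex_eq_two {X : Type*} [Group X] {A C G H : Subgroup X}
    (hfact : ∀ x : X, ∃ g ∈ G, ∃ y ∈ C, x = g * y) (hA : A.relIndex G = 2)
    (hAH : A ≤ H) (hCH : C ≤ H) {b : X} (hbG : b ∈ G) (hbH : b ∉ H) :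
    (H : Set X) = (A : Set X) * (C : Set X) := by
  refine Set.Subset.antisymm (fun x hx => ?_) ?_
  · obtain ⟨g, hg, y, hy, rfl⟩ := hfact x
    have hgH : g ∈ H := (H.mul_mem_cancel_right (hCH hy)).mp hx
    refine Set.mul_mem_mul ?_ hy
    by_contra hgA
    have hmul := mul_mem_iff_of_index_two hA (a := ⟨g, hg⟩) (b := ⟨b, hbG⟩)
    simp only [mem_subgroupOf, coe_mul] at hmul
    exact hbH ((H.mul_mem_cancel_left hgH).mp (hAH (hmul.mpr
      ⟨fun h => absurd h hgA, fun h => absurd (hAH h) hbH⟩)))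
  · rintro _ ⟨u, hu, v, hv, rfl⟩
    exact mul_mem (hAH hu) (hCH hv)

/-- Given index-two subgroups `K` and `M`, the elements lying in both or in neither of them form
a subgroup. -/
def indexTwoXnor {X : Type*} [Group X] (K M : Subgroup X) (hK : K.index = 2) (hM : M.index = 2) :
    Subgroup X where
  carrier := {x | x ∈ K ↔ x ∈ M}
  one_mem' := by simp [one_mem]
  mul_mem' {x y} hx hy := by
    simp only [Set.mem_ofPred_eq] at *
    rw [mul_mem_iff_of_index_two hK, mul_mem_iff_of_index_two hM, hx, hy]
  inv_mem' {x} hx := by simpa using hx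

/-- A proper subgroup of a finite `2`-group lies in a subgroup of index two. -/
theorem IsPGroup.exists_le_index_eq_two {X : Type*} [Group X] [Finite X] (hX : IsPGroup 2 X)
    {G : Subgroup X} (hG : G ≠ ⊤) : ∃ M : Subgroup X, G ≤ M ∧ M.index = 2 := by
  have : Fact (Nat.Prime 2) := ⟨Nat.prime_two⟩
  obtain ⟨r, hr⟩ := IsPGroup.iff_card.mp hX
  obtain ⟨s, hs⟩ := IsPGroup.iff_card.mp (hX.to_subgroup G)
  have hlt : s < r := by
    by_contra! h
    exact hG (eq_top_of_le_card G (by rw [hr, hs]; exact Nat.pow_le_pow_right two_pos h))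
  obtain ⟨t, rfl⟩ := Nat.exists_eq_add_of_lt hlt
  obtain ⟨M, hM, hGM⟩ := Sylow.exists_subgroup_card_pow_prime_le (G := X) (p := 2) (n := s)
    (m := s + t) (hr ▸ pow_dvd_pow 2 (by omega)) G hs (by omega)
  refine ⟨M, hGM, ?_⟩
  have := M.card_mul_index
  rw [hM, hr, pow_succ] at this
  exact Nat.eq_of_mul_eq_mul_left (by positivity) this

/-- maximal class setup: if the core `G_X` is a proper subgroup of
`⟨a⟩` with `|G_X| ≥ 4`, then the set `⟨a⟩⟨c⟩` is a proper subgroup of `X`. -/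
theorem ac_proper_subgroup_of_maximal_class_setup
    {X : Type*} [Group X] [Finite X] (hX2 : IsPGroup 2 X)
    (n m : ℕ) (hn : 5 ≤ n)
    (a b c : X) (G C : Subgroup X)
    (hG : G = Subgroup.closure {a, b})
    (hC : C = Subgroup.zpowers c)
    (hGcard : Nat.card G = 2 ^ n)
    (hCcard : Nat.card C = 2 ^ m)
    (ha : orderOf a = 2 ^ (n - 1))
    (hrel : (b ^ 2 = 1 ∧ b⁻¹ * a * b = a⁻¹) ∨
            (b ^ 2 = a ^ 2 ^ (n - 2) ∧ b⁻¹ * a * b = a⁻¹) ∨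
            (b ^ 2 = 1 ∧ b⁻¹ * a * b = a ^ (2 ^ (n - 2) - 1)))
    (hfact : ∀ x : X, ∃ g ∈ G, ∃ y ∈ C, x = g * y)
    (hdisj : G ⊓ C = ⊥)
    (hcore : C.normalCore = ⊥)
    (hlt : G.normalCore < Subgroup.zpowers a)
    (hge : 4 ≤ Nat.card G.normalCore) :
    ∃ H : Subgroup X,
      (H : Set X) = (Subgroup.zpowers a : Set X) * (Subgroup.zpowers c : Set X) ∧
      H ≠ ⊤ := by
  obtain ⟨k, rfl⟩ := Nat.exists_eq_add_of_le' (show 3 ≤ n by omega)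
  simp only [show k + 3 - 1 = k + 2 by omega, show k + 3 - 2 = k + 1 by omega] at ha hrel
  have haG : a ∈ G := hG ▸ subset_closure (by simp)
  have hbG : b ∈ G := hG ▸ subset_closure (by simp)
  have hA : (zpowers a).relIndex G = 2 := by
    have h := ((zpowers a).subgroupOf G).card_mul_index
    rw [Nat.card_congr (subgroupOfEquivOfLe (zpowers_le.mpr haG)).toEquiv] at h
    rw [Nat.card_zpowers, ha, hGcard, pow_succ 2 (k + 2)] at h
    exact Nat.eq_of_mul_eq_mul_left (by positivity) h
  suffices h : ∃ H : Subgroup X, a ∈ H ∧ c ∈ H ∧ b ∉ H by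
    obtain ⟨H, haH, hcH, hbH⟩ := h
    subst hC
    exact ⟨H, coe_eq_mul_of_relIndex_eq_two hfact hA (zpowers_le.mpr haH) (zpowers_le.mpr hcH)
      hbG hbH, fun h => hbH (h ▸ mem_top b)⟩
  have hzN : a ^ 2 ^ k ∈ G.normalCore := pow_two_pow_mem_of_le_zpowers ha hlt.le hge
  have hz4 : orderOf (a ^ 2 ^ k) = 4 := by
    rw [orderOf_pow_of_dvd (by positivity) (ha ▸ pow_dvd_pow 2 (by omega)), ha,
      Nat.pow_div (by omega) (by norm_num)]
    simp
  have hconj (x : X) : x * a ^ 2 ^ k * x⁻¹ = a ^ 2 ^ k ∨ x * a ^ 2 ^ k * x⁻¹ = (a ^ 2 ^ k)⁻¹ :=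
    eq_or_eq_inv_of_mem_zpowers_of_orderOf_eq_four ha
      (hlt.le (G.normalCore_normal.conj_mem _ hzN x))
      (by rw [← hz4]; exact (MulAut.conj x).orderOf_eq (a ^ 2 ^ k))
  have hbz : b⁻¹ * a ^ 2 ^ k * b = (a ^ 2 ^ k)⁻¹ := by
    have hpow : b⁻¹ * a ^ 2 ^ k * b = (b⁻¹ * a * b) ^ 2 ^ k := by
      simpa using (conj_pow (i := 2 ^ k) (a := b⁻¹) (b := a)).symm
    rw [hpow]
    rcases hrel with ⟨-, h⟩ | ⟨-, h⟩ | ⟨-, h⟩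
    · rw [h, inv_pow]
    · rw [h, inv_pow]
    · rw [h, eq_inv_iff_mul_eq_one, ← pow_mul, ← pow_add, ← orderOf_dvd_iff_pow_eq_one, ha,
        ← Nat.succ_mul, Nat.succ_eq_add_one, Nat.sub_add_cancel Nat.one_le_two_pow, ← pow_add]
      exact pow_dvd_pow 2 (by omega)
  have hzinv : (a ^ 2 ^ k)⁻¹ ≠ a ^ 2 ^ k := by
    intro h
    have h2 : (a ^ 2 ^ k) ^ 2 = 1 := by rw [pow_two]; nth_rewrite 1 [← h]; simp
    have := Nat.le_of_dvd two_pos (orderOf_dvd_of_pow_eq_one h2)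
    omega
  generalize hz : a ^ 2 ^ k = z at *
  have hmemK (x : X) : x ∈ centralizer {z} ↔ x * z * x⁻¹ = z := by
    rw [mem_centralizer_singleton_iff, mul_inv_eq_iff_eq_mul]
  have hbK : b ∉ centralizer {z} := by
    rw [← inv_mem_iff, hmemK, inv_inv, hbz]
    exact hzinv
  have haK : a ∈ centralizer {z} := by
    rw [mem_centralizer_singleton_iff, ← hz]
    exact (Commute.self_pow a _).eq
  have hK : (centralizer {z}).index = 2 := by
    refine index_eq_two_iff.mpr ⟨b⁻¹, fun x => ?_⟩
    have hxb : x * b⁻¹ * z * (x * b⁻¹)⁻¹ = (x * z * x⁻¹)⁻¹ := by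
      calc _ = x * (b⁻¹ * z * b) * x⁻¹ := by group
        _ = _ := by rw [hbz]; group
    rw [hmemK, hmemK, hxb]
    rcases hconj x with h | h
    · rw [h]; exact Or.inr ⟨rfl, hzinv⟩
    · rw [h, inv_inv]; exact Or.inl ⟨rfl, hzinv⟩
  by_cases hcK : c ∈ centralizer {z}
  · exact ⟨_, haK, hcK, hbK⟩
  have hcG : c ∉ G := fun hc => by
    have : c ∈ G ⊓ C := ⟨hc, hC ▸ mem_zpowers c⟩
    rw [hdisj, mem_bot] at this
    exact hcK (this ▸ one_mem _)
  obtain ⟨M, hGM, hM⟩ := hX2.exists_le_index_eq_two (G := G) (fun h => hcG (h ▸ mem_top c))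
  have hcM : c ∉ M := fun hc => by
    have htop : M = ⊤ := (eq_top_iff' M).mpr fun x => by
      obtain ⟨g, hg, y, hy, rfl⟩ := hfact x
      exact mul_mem (hGM hg) (zpowers_le.mpr hc (hC ▸ hy))
    rw [htop, index_top] at hM
    omega
  exact ⟨indexTwoXnor _ M hK hM, iff_of_true haK (hGM haG), iff_of_false hcK hcM,
    fun h => hbK (h.mpr (hGM hbG))⟩
end

section
/- Assume the maximal class setup and suppose additionally that the core G_X of G in X equals ⟨a², b⟩. Then there exist integers r, s, t, v and u ∈ {0, 1} such that c⁻¹a²c = a^{2r}, b⁻¹cb = a^{2s}c, and a⁻¹ca = a^{2t}b^u c^v, where r^{2^m} ≡ 1 (mod 2^{n−2}) and s·Σ_{l=1}^{2^m} r^l ≡ 0 (mod 2^{n−2}), and moreover: if u = 0, then r^{v−1} ≡ 1 (mod 2^{n−2}), (s+2t)r ≡ (1−r) + s·Σ_{l=1}^{v} r^l (mod 2^{n−2}), t·Σ_{l=1}^{2^m} r^l ≡ 0 (mod 2^{n−2}), v² ≡ 1 (mod 2^m), and 1 − r ≡ tr + t·Σ_{l=1}^{v} r^l (mod 2^{n−2});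 if u = 1, then r^{v−1} + 1 ≡ 0 (mod 2^{n−2}), (sr + 1 − r)·Σ_{l=0}^{v−1} r^l ≡ (s + 2t + 1)r (mod 2^{n−1}), (t(1 − r^{−1}) + s·Σ_{l=0}^{v−1} r^l)·Σ_{l=0}^{2^{m−1}−1} r^{2l} ≡ 0 (mod 2^{n−2}), and r²·(t(1 − r^{−1}) + s·(r^v − 1)/(r − 1))·(r^{v−1} − 1)/(r² − 1) + 2^{n−3}·i ≡ 0 (mod 2^{n−2}), where i = (v+1)/2 if G is generalized quaternion and i = 0 otherwise (here r is odd, so r^{−1} denotes the inverse of r modulo 2^{n−2}). -/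
open Subgroup Finset

section

variable {X : Type*} [Group X]

theorem zpow_mul_eq_mul_zpow_of_conj {x d : X} {r : ℤ} (h : d⁻¹ * x * d = x ^ r) (j : ℤ) :
    x ^ j * d = d * x ^ (j * r) := by
  have h1 : d⁻¹ * x ^ j * d = (d⁻¹ * x * d) ^ j := by
    simpa using (conj_zpow (i := j) (a := d⁻¹) (b := x)).symm
  rw [mul_comm j r, zpow_mul, ← h, ← h1]
  group

theorem zpow_mul_pow_eq_of_conj {x d : X} {r : ℤ} (h : d⁻¹ * x * d = x ^ r) (j : ℤ) (k : ℕ) :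
    x ^ j * d ^ k = d ^ k * x ^ (j * r ^ k) := by
  induction k with
  | zero => simp
  | succ k ih =>
    rw [pow_succ, ← mul_assoc, ih, mul_assoc, zpow_mul_eq_mul_zpow_of_conj h, pow_succ]
    simp only [mul_assoc]

theorem zpow_mul_pow_eq_pow_mul_zpow_sum {x d : X} {r : ℤ} (h : d⁻¹ * x * d = x ^ r) (s : ℤ)
    (k : ℕ) : (x ^ s * d) ^ k = d ^ k * x ^ (s * ∑ l ∈ Icc 1 k, r ^ l) := by
  induction k with
  | zero => simp
  | succ k ih =>
    rw [pow_succ', ih, ← mul_assoc, mul_assoc (x ^ s), ← pow_succ', zpow_mul_pow_eq_of_conj h,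
      mul_assoc, ← zpow_add, Finset.sum_Icc_succ_top (by omega)]
    congr 2
    ring

/-- Elements of `⟨x, b⟩` when `b` inverts `x` and `b² ∈ ⟨x⟩`. -/
theorem mem_closure_pair_of_conj_inv {x b : X} (hb : b⁻¹ * x * b = x⁻¹) {e : ℤ}
    (hb2 : b ^ 2 = x ^ e) {g : X} (hg : g ∈ closure {x, b}) :
    ∃ k : ℤ, ∃ u : ℕ, (u = 0 ∨ u = 1) ∧ g = x ^ k * b ^ u := by
  have hb' : b⁻¹ * x * b = x ^ (-1 : ℤ) := by simpa using hb
  have hcomm : ∀ k : ℤ, b * x ^ k = x ^ (-k) * b := fun k => by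
    rw [zpow_mul_eq_mul_zpow_of_conj hb']; simp
  have hinv : b⁻¹ = x ^ (-e) * b := by
    rw [zpow_neg, ← hb2]; group
  induction hg using closure_induction with
  | mem y hy =>
    rcases hy with rfl | rfl
    · exact ⟨1, 0, Or.inl rfl, by simp⟩
    · exact ⟨0, 1, Or.inr rfl, by simp⟩
  | one => exact ⟨0, 0, Or.inl rfl, by simp⟩
  | mul y z _ _ hy hz =>
    obtain ⟨k, u, rfl | rfl, rfl⟩ := hy <;> obtain ⟨l, w, rfl | rfl, rfl⟩ := hz
    · exact ⟨k + l, 0, Or.inl rfl, by simp [zpow_add]⟩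
    · exact ⟨k + l, 1, Or.inr rfl, by simp [zpow_add, mul_assoc]⟩
    · refine ⟨k - l, 1, Or.inr rfl, ?_⟩
      rw [pow_one, pow_zero, mul_one, mul_assoc, hcomm, ← mul_assoc, ← zpow_add, sub_eq_add_neg]
    · refine ⟨k - l + e, 0, Or.inl rfl, ?_⟩
      rw [pow_one, pow_zero, mul_one, mul_assoc, ← mul_assoc b, hcomm, mul_assoc (x ^ (-l)),
        ← sq, hb2, ← mul_assoc, ← zpow_add, ← zpow_add, sub_eq_add_neg]
  | inv y _ hy =>
    obtain ⟨k, u, rfl | rfl, rfl⟩ := hy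
    · exact ⟨-k, 0, Or.inl rfl, by simp⟩
    · refine ⟨k - e, 1, Or.inr rfl, ?_⟩
      rw [pow_one, mul_inv_rev, hinv, ← zpow_neg, mul_assoc, hcomm, ← mul_assoc, ← zpow_add]
      congr 2
      ring

theorem mem_or_inv_mul_mem_of_mem_closure_pair {a b g : X} {N : Subgroup X} [N.Normal]
    (ha : a ^ 2 ∈ N) (hb : b ∈ N) (hg : g ∈ closure {a, b}) : g ∈ N ∨ a⁻¹ * g ∈ N := by
  have key : ∀ y : X, y ∈ N ↔ (y : X ⧸ N) = 1 := fun y => (QuotientGroup.eq_one_iff y).symm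
  rw [key] at ha hb
  have ha1 : (a : X ⧸ N) * a = 1 := by rw [← sq]; simpa using ha
  have ha2 : (a : X ⧸ N)⁻¹ = a := inv_eq_of_mul_eq_one_left ha1
  have h3 : ∀ w : X, (a : X ⧸ N) * w = 1 → (w : X ⧸ N) = a := fun w hw => by
    rw [← ha2]; exact eq_inv_of_mul_eq_one_right hw
  simp only [key, QuotientGroup.mk_mul, QuotientGroup.mk_inv, ha2]
  induction hg using closure_induction with
  | mem y hy =>
    rcases hy with rfl | rfl
    · exact Or.inr ha1
    · exact Or.inl hb
  | one => simp
  | mul y z _ _ hy hz =>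
    rcases hy with hy | hy <;> rcases hz with hz | hz
    · left; simp [hy, hz]
    · right; simp [hy, hz]
    · right; rw [QuotientGroup.mk_mul, hz, mul_one, hy]
    · left; simp [h3 y hy, h3 z hz, ha1]
  | inv y _ hy =>
    rcases hy with hy | hy
    · left; simp [hy]
    · right
      simp [h3 y hy]

end

/-- maximal class setup, `G_X = ⟨a², b⟩`: there are integers
`r, s, t`, a natural number `v ≥ 1` and `u ∈ {0, 1}` with `c⁻¹a²c = a^{2r}`,
`b⁻¹cb = a^{2s}c`, `a⁻¹ca = a^{2t}b^u c^v`, subject to the congruences of the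
paper; quotients such as `(r^v−1)/(r−1)` are written as geometric sums, and
`r⁻¹ mod 2^{n-2}` as an integer `r'` with `r·r' ≡ 1 (mod 2^{n-2})`. -/
theorem core_a2b_case_of_maximal_class_setup
    {X : Type*} [Group X] [Finite X] (hX2 : IsPGroup 2 X)
    (n m : ℕ) (hn : 5 ≤ n)
    (a b c : X) (G C : Subgroup X)
    (hG : G = Subgroup.closure {a, b})
    (hC : C = Subgroup.zpowers c)
    (hGcard : Nat.card G = 2 ^ n)
    (hCcard : Nat.card C = 2 ^ m)
    (ha : orderOf a = 2 ^ (n - 1))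
    (hrel : (b ^ 2 = 1 ∧ b⁻¹ * a * b = a⁻¹) ∨
            (b ^ 2 = a ^ 2 ^ (n - 2) ∧ b⁻¹ * a * b = a⁻¹) ∨
            (b ^ 2 = 1 ∧ b⁻¹ * a * b = a ^ (2 ^ (n - 2) - 1)))
    (hfact : ∀ x : X, ∃ g ∈ G, ∃ y ∈ C, x = g * y)
    (hdisj : G ⊓ C = ⊥)
    (hcore : C.normalCore = ⊥)
    (hGX : G.normalCore = Subgroup.closure {a ^ 2, b}) :
    ∃ (r s t : ℤ) (u v : ℕ),
      (u = 0 ∨ u = 1) ∧ 1 ≤ v ∧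
      c⁻¹ * a ^ 2 * c = (a ^ 2) ^ r ∧
      b⁻¹ * c * b = (a ^ 2) ^ s * c ∧
      a⁻¹ * c * a = (a ^ 2) ^ t * b ^ u * c ^ v ∧
      (2 ^ (n - 2) : ℤ) ∣ r ^ 2 ^ m - 1 ∧
      (2 ^ (n - 2) : ℤ) ∣ s * ∑ l ∈ Finset.Icc 1 (2 ^ m), r ^ l ∧
      ((u = 0 ∧
          (2 ^ (n - 2) : ℤ) ∣ r ^ (v - 1) - 1 ∧
          (2 ^ (n - 2) : ℤ) ∣
            (s + 2 * t) * r - ((1 - r) + s * ∑ l ∈ Finset.Icc 1 v, r ^ l) ∧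
          (2 ^ (n - 2) : ℤ) ∣ t * ∑ l ∈ Finset.Icc 1 (2 ^ m), r ^ l ∧
          (2 ^ m : ℤ) ∣ (v : ℤ) ^ 2 - 1 ∧
          (2 ^ (n - 2) : ℤ) ∣
            (1 - r) - (t * r + t * ∑ l ∈ Finset.Icc 1 v, r ^ l)) ∨
       (u = 1 ∧ ∃ r' i : ℤ,
          (2 ^ (n - 2) : ℤ) ∣ r * r' - 1 ∧
          ((b ^ 2 = a ^ 2 ^ (n - 2) ∧ i = (((v + 1) / 2 : ℕ) : ℤ)) ∨
           (b ^ 2 = 1 ∧ i = 0)) ∧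
          (2 ^ (n - 2) : ℤ) ∣ r ^ (v - 1) + 1 ∧
          (2 ^ (n - 1) : ℤ) ∣
            (s * r + 1 - r) * (∑ l ∈ Finset.range v, r ^ l) - (s + 2 * t + 1) * r ∧
          (2 ^ (n - 2) : ℤ) ∣
            (t * (1 - r') + s * ∑ l ∈ Finset.range v, r ^ l) *
              ∑ l ∈ Finset.range (2 ^ (m - 1)), r ^ (2 * l) ∧
          (2 ^ (n - 2) : ℤ) ∣
            r ^ 2 * (t * (1 - r') + s * ∑ l ∈ Finset.range v, r ^ l) *
              (∑ l ∈ Finset.range ((v - 1) / 2), r ^ (2 * l)) +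
            2 ^ (n - 3) * i)) := by
  have hP : (2 : ℕ) ^ (n - 1) = 2 * 2 ^ (n - 2) := by
    rw [← pow_succ']; congr 1; omega
  have hQ : (2 : ℕ) ^ (n - 2) = 2 * 2 ^ (n - 3) := by
    rw [← pow_succ']; congr 1; omega
  have h8Q : 8 ∣ 2 ^ (n - 2) := pow_dvd_pow 2 (show 3 ≤ n - 2 by omega)
  have hQ8 : 8 ≤ 2 ^ (n - 2) := Nat.le_of_dvd (by positivity) h8Q
  have hxord : orderOf (a ^ 2) = 2 ^ (n - 2) := by
    rw [orderOf_pow' a two_ne_zero, ha, hP, Nat.gcd_eq_right (Dvd.intro _ rfl)]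
    omega
  have hcord : orderOf c = 2 ^ m := by rw [← Nat.card_zpowers, ← hC, hCcard]
  have haG : a ∈ G := hG ▸ subset_closure (by simp)
  obtain ⟨w, hwr, hab⟩ : ∃ w : ℤ, (∀ r : ℤ, Odd r → (2 ^ (n - 2) : ℤ) ∣ (w - 1) * (1 - r)) ∧
      a⁻¹ * b * a = b * (a ^ 2) ^ w := by
    have e : a⁻¹ * b * a = b * ((b⁻¹ * a * b)⁻¹ * a) := by group
    rcases hrel with ⟨-, h⟩ | ⟨-, h⟩ | ⟨-, h⟩
    · exact ⟨1, by simp, by rw [e, h]; simp [sq]⟩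
    · exact ⟨1, by simp, by rw [e, h]; simp [sq]⟩
    · refine ⟨1 - 2 ^ (n - 3), ?_, ?_⟩
      · rintro r ⟨k, rfl⟩
        have hQ' : (2 : ℤ) ^ (n - 2) = 2 * 2 ^ (n - 3) := by exact_mod_cast hQ
        exact ⟨k, by rw [hQ']; ring⟩
      · have hQ' : (2 : ℤ) ^ (n - 2) = 2 * 2 ^ (n - 3) := by exact_mod_cast hQ
        rw [e, h]
        congr 1
        rw [← zpow_natCast a 2, ← zpow_mul, ← zpow_natCast, ← zpow_neg, ← zpow_add_one]
        congr 1
        rw [Nat.cast_sub (by omega)]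
        push_cast
        rw [hQ']
        ring
  obtain ⟨hbx, hb2⟩ : b⁻¹ * a ^ 2 * b = (a ^ 2)⁻¹ ∧ (b ^ 2 = 1 ∨ b ^ 2 = a ^ 2 ^ (n - 2)) := by
    have e : b⁻¹ * a ^ 2 * b = (b⁻¹ * a * b) ^ 2 := by rw [sq, sq]; group
    rcases hrel with ⟨h', h⟩ | ⟨h', h⟩ | ⟨h', h⟩
    · exact ⟨by rw [e, h, inv_pow], Or.inl h'⟩
    · exact ⟨by rw [e, h, inv_pow], Or.inr h'⟩
    · refine ⟨?_, Or.inl h'⟩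
      rw [e, h, eq_inv_iff_mul_eq_one, ← pow_mul, ← pow_add, show
        (2 ^ (n - 2) - 1) * 2 + 2 = 2 ^ (n - 1) by omega, ← ha, pow_orderOf_eq_one]
  have hb4 : b ^ 4 = 1 := by
    rw [show 4 = 2 * 2 from rfl, pow_mul]
    rcases hb2 with h | h
    · rw [h, one_pow]
    · rw [h, ← pow_mul, show 2 ^ (n - 2) * 2 = 2 ^ (n - 1) by omega, ← ha, pow_orderOf_eq_one]
  obtain ⟨e, hbe⟩ : ∃ e : ℤ, b ^ 2 = (a ^ 2) ^ e := by
    rcases hb2 with h | h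
    · exact ⟨0, by simpa using h⟩
    · refine ⟨(2 ^ (n - 3) : ℕ), ?_⟩
      rw [h, zpow_natCast, ← pow_mul, ← hQ]
  set N : Subgroup X := closure {a ^ 2, b} with hN
  have hNn : N.Normal := hGX ▸ normalCore_normal G
  have hNG : N ≤ G := hGX ▸ normalCore_le G
  have hxN : a ^ 2 ∈ N := subset_closure (by simp)
  have hbN : b ∈ N := subset_closure (by simp)
  have hax : a * a ^ 2 = a ^ 2 * a := by rw [← pow_succ, ← pow_succ']
  have hcG : ∀ k : ℕ, c ^ k ∈ G → c ^ k = 1 := fun k hk => by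
    have : c ^ k ∈ G ⊓ C := ⟨hk, hC ▸ pow_mem (mem_zpowers c) k⟩
    rwa [hdisj, mem_bot] at this
  have hNform : ∀ g ∈ N, ∃ k : ℤ, ∃ u : ℕ, (u = 0 ∨ u = 1) ∧ g = (a ^ 2) ^ k * b ^ u :=
    fun g hg => mem_closure_pair_of_conj_inv hbx hbe hg
  have hdvd : ∀ i j : ℤ, (a ^ 2) ^ i = (a ^ 2) ^ j → (2 ^ (n - 2) : ℤ) ∣ i - j := by
    intro i j h
    have h1 : ((orderOf (a ^ 2) : ℕ) : ℤ) ∣ i - j := by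
      rw [orderOf_dvd_iff_zpow_eq_one, zpow_sub, h, mul_inv_cancel]
    rw [hxord] at h1
    exact_mod_cast h1
  have h8 : (8 : ℤ) ∣ 2 ^ (n - 2) := by exact_mod_cast h8Q
  have hbnx : ∀ k : ℤ, b ≠ (a ^ 2) ^ k := by
    intro k hk
    have h1 : (a ^ 2) ^ (1 : ℤ) = (a ^ 2) ^ (-1 : ℤ) := by
      rw [zpow_one, zpow_neg_one, ← hbx, hk]
      group
    have := h8.trans (hdvd _ _ h1)
    norm_num at this
  have hbxz : b⁻¹ * a ^ 2 * b = (a ^ 2) ^ (-1 : ℤ) := by simpa using hbx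
  generalize hx : a ^ 2 = x at *
  have haN : a ∉ N := by
    intro h
    obtain ⟨k, u, rfl | rfl, hk⟩ := hNform a h
    · rw [pow_zero, mul_one] at hk
      have h1 : x ^ (1 : ℤ) = x ^ (2 * k) := by
        rw [zpow_one, mul_comm, zpow_mul, ← hk, ← hx]; norm_cast
      have := h8.trans (hdvd _ _ h1)
      omega
    · have h0 : b = x ^ (-k) * a := by rw [hk]; group
      have h1 : x ^ (1 : ℤ) = x ^ (-1 : ℤ) := by
        have hxa : Commute x a := hax.symm
        have hxb : Commute x b := h0 ▸ ((Commute.refl x).zpow_right (-k)).mul_right hxa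
        rw [← hbxz, zpow_one, mul_assoc, hxb.eq, inv_mul_cancel_left]
      have := h8.trans (hdvd _ _ h1)
      norm_num at this
  -- the action of `c` on `⟨a²⟩`
  obtain ⟨r, hr⟩ : ∃ r : ℤ, c⁻¹ * x * c = x ^ r := by
    have h1 : c⁻¹ * x * c ∈ N := by simpa using hNn.conj_mem x hxN c⁻¹
    obtain ⟨k, u, rfl | rfl, hk⟩ := hNform _ h1
    · exact ⟨k, by simpa using hk⟩
    · exfalso
      have h2 : (x ^ k * b) ^ 4 = 1 := by
        rw [show 4 = 2 * 2 from rfl, pow_mul]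
        have h3 : (x ^ k * b) ^ 2 = b ^ 2 := by
          rw [sq, ← mul_assoc, zpow_mul_eq_mul_zpow_of_conj hbxz, mul_assoc b, ← zpow_add, sq]
          simp
        rw [h3, ← pow_mul, hb4]
      rw [pow_one] at hk
      rw [← hk] at h2
      have h3 : (c⁻¹ * x * c) ^ 4 = c⁻¹ * x ^ 4 * c := by
        simpa using conj_pow (i := 4) (a := c⁻¹) (b := x)
      have h4 : x ^ (4 : ℤ) = x ^ (0 : ℤ) := by
        rw [zpow_zero]
        have : x ^ 4 = c * (c⁻¹ * x ^ 4 * c) * c⁻¹ := by group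
        rw [h3.symm, h2] at this
        exact_mod_cast (by simpa using this : x ^ 4 = 1)
      have := h8.trans (hdvd _ _ h4)
      norm_num at this
  -- the action of `b` on `c`
  obtain ⟨s, hs⟩ : ∃ s : ℤ, b⁻¹ * c * b = x ^ s * c := by
    obtain ⟨k, u, rfl | rfl, hk⟩ := hNform _ (hNn.conj_mem b hbN c)
    · exfalso
      apply hbnx (k * r)
      rw [pow_zero, mul_one] at hk
      have h1 := zpow_mul_eq_mul_zpow_of_conj hr k
      rw [← hk] at h1
      simpa [mul_assoc] using h1
    · refine ⟨-k, ?_⟩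
      rw [pow_one, zpow_mul_eq_mul_zpow_of_conj hbxz] at hk
      rw [mul_assoc, show c * b = c * b * c⁻¹ * c by group, hk]
      simp [mul_assoc]
  -- the action of `a` on `c`
  obtain ⟨g, hgN, v, hv1, hv⟩ : ∃ g ∈ N, ∃ v : ℕ, 1 ≤ v ∧ a⁻¹ * c * a = g * c ^ v := by
    obtain ⟨g, hg, y, hy, hgy⟩ := hfact (a⁻¹ * c * a)
    rw [hC, ← mem_powers_iff_mem_zpowers] at hy
    obtain ⟨k, rfl⟩ := hy
    dsimp only at hgy
    refine ⟨g, ?_, k + 2 ^ m, by have := Nat.one_le_two_pow (n := m); omega, by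
      rw [hgy, pow_add, ← hcord, pow_orderOf_eq_one, mul_one]⟩
    rw [hG] at hg
    refine (mem_or_inv_mul_mem_of_mem_closure_pair (hx ▸ hxN) hbN hg).resolve_right fun hg' => ?_
    have hA : (a : X ⧸ N) * a = 1 := by
      rw [← QuotientGroup.mk_mul, QuotientGroup.eq_one_iff, ← sq, hx]
      exact hxN
    have hgA : (a : X ⧸ N)⁻¹ * g = 1 := by
      rwa [← QuotientGroup.mk_inv, ← QuotientGroup.mk_mul, QuotientGroup.eq_one_iff]
    have h1 : (a : X ⧸ N)⁻¹ * c * a = g * c ^ k := congrArg (QuotientGroup.mk' N) hgy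
    obtain ⟨j, hj⟩ : ∃ j : ℕ, c * c ^ j = c ^ k := ⟨k + (2 ^ m - 1), by
      have := Nat.one_le_two_pow (n := m)
      rw [← pow_succ', add_assoc, Nat.sub_add_cancel this, pow_add, ← hcord, pow_orderOf_eq_one,
        mul_one]⟩
    have hj' : (c : X ⧸ N) * c ^ j = c ^ k := congrArg (QuotientGroup.mk' N) hj
    have h2 : (a : X ⧸ N) = c ^ j := by
      rw [← inv_mul_eq_one.mp hgA, mul_assoc, inv_mul_eq_iff_eq_mul, ← mul_assoc,
        hA, one_mul, ← hj'] at h1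
      exact mul_left_cancel h1
    have h3 : a⁻¹ * c ^ j ∈ N := by
      rw [← QuotientGroup.eq_one_iff, QuotientGroup.mk_mul, QuotientGroup.mk_inv,
        QuotientGroup.mk_pow, ← h2, inv_mul_cancel]
    have h4 : c ^ j ∈ G := by simpa using mul_mem haG (hNG h3)
    rw [hcG j h4, mul_one] at h3
    exact haN (by simpa using inv_mem h3)
  obtain ⟨t, u, hu, rfl⟩ := hNform g hgN
  have hrv := zpow_mul_pow_eq_of_conj hr
  have hr2 : (2 ^ (n - 2) : ℤ) ∣ r ^ 2 ^ m - 1 := by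
    apply hdvd
    have := hrv 1 (2 ^ m)
    rw [← hcord, pow_orderOf_eq_one, hcord] at this
    simpa using this.symm
  have hrodd : Odd r := by
    rw [← Int.not_even_iff_odd, even_iff_two_dvd]
    intro h
    have h1 : (2 : ℤ) ∣ r ^ 2 ^ m := dvd_pow h (by positivity)
    have h2 := h8.trans hr2
    omega
  have hsum : ∀ s : ℤ, (x ^ s * c) ^ 2 ^ m = 1 →
      (2 ^ (n - 2) : ℤ) ∣ s * ∑ l ∈ Icc 1 (2 ^ m), r ^ l := by
    intro s h
    rw [zpow_mul_pow_eq_pow_mul_zpow_sum hr, ← hcord, pow_orderOf_eq_one, hcord, one_mul] at h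
    simpa using hdvd _ 0 (by simpa using h)
  have hcm : c ^ 2 ^ m = 1 := hcord ▸ pow_orderOf_eq_one c
  have hbconj : ∀ y k, (b⁻¹ * y * b) ^ k = b⁻¹ * y ^ k * b := fun y k => by
    simpa using conj_pow (i := k) (a := b⁻¹) (b := y)
  have haconj : ∀ y k, (a⁻¹ * y * a) ^ k = a⁻¹ * y ^ k * a := fun y k => by
    simpa using conj_pow (i := k) (a := a⁻¹) (b := y)
  have hxa : Commute x a := hax.symm
  have hxca : x * (a⁻¹ * c * a) = a⁻¹ * c * a * x ^ r := by
    have h1 := zpow_mul_eq_mul_zpow_of_conj hr 1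
    rw [zpow_one, one_mul] at h1
    calc x * (a⁻¹ * c * a) = a⁻¹ * (x * c) * a := by
          rw [mul_assoc, ← mul_assoc x, hxa.inv_right.eq]; simp only [mul_assoc]
      _ = a⁻¹ * c * a * x ^ r := by
          rw [h1, mul_assoc, mul_assoc, (hxa.zpow_left r).eq]; simp only [mul_assoc]
  refine ⟨r, s, t, u, v, hu, hv1, hr, hs, hv, hr2, hsum s ?_, ?_⟩
  · rw [← hs, hbconj, hcm]; simp
  rcases hu with rfl | rfl
  · refine Or.inl ⟨rfl, ?_⟩
    rw [pow_zero, mul_one] at hv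
    have hxr : x ^ r ^ v = x ^ r := by
      have h1 := hrv 1 v
      rw [zpow_one, one_mul] at h1
      rw [hv, ← mul_assoc, ← zpow_one_add, add_comm, zpow_add_one, mul_assoc, h1,
        ← mul_assoc] at hxca
      exact mul_left_cancel hxca
    have hrdvd : (2 ^ (n - 2) : ℤ) ∣ r ^ (v - 1) - 1 := by
      have h1 := hdvd _ _ hxr
      obtain ⟨k, rfl⟩ : ∃ k, v = k + 1 := ⟨v - 1, by omega⟩
      rw [show r ^ (k + 1) - r = r * (r ^ k - 1) by ring] at h1
      exact (IsCoprime.pow_left (Int.isCoprime_two_left.mpr hrodd)).dvd_of_dvd_mul_left h1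
    have hd : (c ^ v)⁻¹ * x * c ^ v = x ^ r := by
      have h1 := hrv 1 v
      rw [zpow_one, one_mul, hxr] at h1
      rw [mul_assoc, h1, inv_mul_cancel_left]
    have hdr := zpow_mul_eq_mul_zpow_of_conj hd
    have hdp := zpow_mul_pow_eq_pow_mul_zpow_sum hd
    refine ⟨hrdvd, ?_, ?_, ?_⟩
    · have h1 : (b * x ^ w)⁻¹ * (x ^ t * c ^ v) * (b * x ^ w) = x ^ s * (x ^ t * c ^ v) := by
        have h2 : a⁻¹ * (b⁻¹ * c * b) * a = x ^ s * (a⁻¹ * c * a) := by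
          rw [hs, ← mul_assoc, ← (hxa.inv_right.zpow_left s).eq]
          simp only [mul_assoc]
        rw [← hab, ← hv, ← h2]
        group
      have h2 : b⁻¹ * (x ^ t * c ^ v) * b = c ^ v * x ^ (-t * r + s * ∑ l ∈ Icc 1 v, r ^ l) := by
        calc b⁻¹ * (x ^ t * c ^ v) * b = b⁻¹ * (x ^ t * b) * (b⁻¹ * c ^ v * b) := by group
          _ = x ^ (-t) * (c ^ v * x ^ (s * ∑ l ∈ Icc 1 v, r ^ l)) := by
            rw [zpow_mul_eq_mul_zpow_of_conj hbxz, inv_mul_cancel_left, ← hbconj, hs,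
              zpow_mul_pow_eq_pow_mul_zpow_sum hr, mul_neg_one]
          _ = _ := by rw [← mul_assoc, hdr, mul_assoc, ← zpow_add]
      have h3 : (b * x ^ w)⁻¹ * (x ^ t * c ^ v) * (b * x ^ w) =
          c ^ v * x ^ (-w * r + (-t * r + s * ∑ l ∈ Icc 1 v, r ^ l) + w) := by
        calc _ = x ^ (-w) * (b⁻¹ * (x ^ t * c ^ v) * b) * x ^ w := by group
          _ = _ := by
            rw [h2, ← mul_assoc, hdr, mul_assoc, mul_assoc, ← zpow_add, ← zpow_add,
              ← add_assoc]
      rw [h3, ← mul_assoc, ← zpow_add, hdr] at h1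
      obtain ⟨k, hk⟩ := dvd_add (hdvd _ _ (mul_left_cancel h1).symm) (hwr r hrodd)
      exact ⟨k, by linear_combination hk⟩
    · have h1 : (x ^ t * c ^ v) ^ 2 ^ m = 1 := by rw [← hv, haconj, hcm]; simp
      rw [hdp, ← pow_mul, mul_comm v, pow_mul, hcm, one_pow, one_mul] at h1
      simpa using hdvd _ 0 (by simpa using h1)
    · have h1 : c * x ^ (1 - r) = c ^ (v * v) * x ^ (t * r + t * ∑ l ∈ Icc 1 v, r ^ l) := by
        have h2 : x⁻¹ * c * x = c * x ^ (1 - r) := by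
          have := zpow_mul_eq_mul_zpow_of_conj hr (-1)
          rw [zpow_neg_one] at this
          rw [this, mul_assoc, ← zpow_add_one]
          congr 2
          ring
        have h3 : x⁻¹ * c * x = a⁻¹ * (a⁻¹ * c * a) * a := by
          rw [← hx, sq]; group
        have h4 : a⁻¹ * x ^ t * a = x ^ t := by
          rw [mul_assoc, (hxa.zpow_left t).eq, inv_mul_cancel_left]
        calc c * x ^ (1 - r) = a⁻¹ * x ^ t * a * (a⁻¹ * c ^ v * a) := by
              rw [← h2, h3, hv]; group
          _ = x ^ t * (c ^ (v * v) * x ^ (t * ∑ l ∈ Icc 1 v, r ^ l)) := by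
              rw [h4, ← haconj, hv, hdp, ← pow_mul]
          _ = _ := by
              rw [pow_mul, ← mul_assoc, zpow_mul_pow_eq_of_conj hd, mul_assoc, mul_comm t (r ^ v),
                zpow_mul x (r ^ v), hxr, ← zpow_mul, ← zpow_add, mul_comm r t]
      obtain ⟨k, hk⟩ : ∃ k, v * v = k + 1 := ⟨v * v - 1, by have := Nat.mul_pos hv1 hv1; omega⟩
      have h2 : x ^ ((1 - r) - (t * r + t * ∑ l ∈ Icc 1 v, r ^ l)) = c ^ k := by
        rw [hk, pow_succ', mul_assoc] at h1
        rw [zpow_sub, mul_left_cancel h1, mul_inv_cancel_right]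
      have h3 : c ^ k = 1 := hcG k (h2 ▸ hNG (zpow_mem hxN _))
      rw [h3] at h2
      refine ⟨?_, by simpa using hdvd _ 0 (by simpa using h2)⟩
      have h4 : 2 ^ m ∣ k := hcord ▸ orderOf_dvd_of_pow_eq_one h3
      rw [sq, show (v : ℤ) * v = k + 1 by exact_mod_cast hk, add_sub_cancel_right]
      exact_mod_cast h4
  · exfalso
    rw [pow_one] at hv
    have hvodd : Odd v := by
      rw [← Nat.not_even_iff_odd]
      rintro ⟨k, rfl⟩
      obtain rfl | hm := Nat.eq_zero_or_pos m
      · have hc1 : c = 1 := by simpa using hcm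
        refine hbnx (-t) ?_
        rw [hc1] at hv
        rw [zpow_neg]
        exact eq_inv_of_mul_eq_one_right (by simpa using hv.symm)
      · obtain ⟨j, rfl⟩ : ∃ j, m = j + 1 := ⟨m - 1, by omega⟩
        have h1 : a⁻¹ * c ^ 2 ^ j * a ∈ N := by
          rw [← haconj, hv, ← QuotientGroup.eq_one_iff]
          have h2 : ((x ^ t * b : X) : X ⧸ N) = 1 := by
            rwa [QuotientGroup.eq_one_iff, ← pow_one b]
          rw [QuotientGroup.mk_pow, QuotientGroup.mk_mul, h2, one_mul, ← QuotientGroup.mk_pow,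
            ← pow_mul, show (k + k) * 2 ^ j = 2 ^ (j + 1) * k by ring, pow_mul, hcm, one_pow,
            QuotientGroup.mk_one]
        have h2 : c ^ 2 ^ j ∈ N := by
          simpa [mul_assoc] using hNn.conj_mem _ h1 a
        have h3 := orderOf_dvd_of_pow_eq_one (hcG _ (hNG h2))
        rw [hcord, Nat.pow_dvd_pow_iff_le_right one_lt_two] at h3
        omega
    obtain ⟨k, rfl⟩ := hvodd
    have h1 : x ^ (-r ^ (2 * k + 1)) = x ^ r := by
      have h2 : x * (x ^ t * b * c ^ (2 * k + 1)) =
          x ^ t * b * c ^ (2 * k + 1) * x ^ (-r ^ (2 * k + 1)) := by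
        have h3 := zpow_mul_eq_mul_zpow_of_conj hbxz 1
        have h4 := hrv (-1) (2 * k + 1)
        rw [zpow_one, one_mul] at h3
        rw [neg_one_mul] at h4
        rw [mul_assoc (x ^ t * b), ← h4, ← mul_assoc, ← mul_assoc, ← mul_assoc,
          mul_assoc (x ^ t) b, ← h3, ← mul_assoc, ((Commute.refl x).zpow_right t).eq]
      rw [hv, h2] at hxca
      exact mul_left_cancel hxca
    have h2 := h8.trans (hdvd _ _ h1)
    have h3 : (8 : ℤ) ∣ r * ((r ^ k) ^ 2 + 1) := by
      rw [← dvd_neg]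
      convert h2 using 1
      ring
    have h4 : (8 : ℤ) ∣ (r ^ k) ^ 2 + 1 :=
      (show IsCoprime (2 ^ 3 : ℤ) r from
        IsCoprime.pow_left (Int.isCoprime_two_left.mpr hrodd)).dvd_of_dvd_mul_left h3
    have h5 := Int.eight_dvd_sq_sub_one_of_odd (hrodd.pow (n := k))
    omega
end

section
/- Assume the maximal class setup and suppose additionally that the core G_X of G in X has order 2. Then m = n − 1; that is, the order of c equals the order of a, namely 2^{n−1}. -/
open Subgroup

/-- An element of a subgroup `H` of a finite `2`-group fixes the base point of `X ⧸ H`, so its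
orbits on the other points are proper; a power outside the core forces a long such orbit. -/
theorem two_pow_succ_lt_index_of_pow_notMem_normalCore {X : Type*} [Group X] [Finite X]
    (hX : IsPGroup 2 X) (H : Subgroup X) {g : X} (hg : g ∈ H) (k : ℕ)
    (hk : g ^ 2 ^ k ∉ H.normalCore) : 2 ^ (k + 1) < H.index := by
  obtain ⟨q, hq⟩ : ∃ q : X ⧸ H, g ^ 2 ^ k • q ≠ q := by
    by_contra! h
    refine hk fun x => ?_
    have hx := h ((x⁻¹ : X) : X ⧸ H)
    rw [← QuotientGroup.mk_mul_of_mem x⁻¹ H.one_mem, mul_one] at hx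
    have hx' := QuotientGroup.eq.mp hx.symm
    simpa [mul_assoc] using hx'
  set P := Function.minimalPeriod (g • ·) q with hP
  obtain ⟨r, hr⟩ := hX g
  obtain ⟨j, -, hj⟩ : ∃ j ≤ r, P = 2 ^ j := by
    rw [← Nat.dvd_prime_pow Nat.prime_two, hP, ← MulAction.pow_smul_eq_iff_minimalPeriod_dvd, hr,
      one_smul]
  have hkj : k + 1 ≤ j := by
    by_contra! hlt
    refine hq (MulAction.pow_smul_eq_iff_minimalPeriod_dvd.mpr ?_)
    rw [← hP, hj]
    exact pow_dvd_pow 2 (by omega)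
  have hfix (z : zpowers g) : z • ((1 : X) : X ⧸ H) = ((1 : X) : X ⧸ H) := by
    have hz : (z : X) ∈ H := (zpowers_le.mpr hg) z.2
    change ((((z : X) * 1 : X)) : X ⧸ H) = _
    exact QuotientGroup.eq.mpr (by simpa using hz)
  have hbase : ((1 : X) : X ⧸ H) ∉ MulAction.orbit (zpowers g) q := by
    rintro ⟨z, hz⟩
    have hq1 : q = ((1 : X) : X ⧸ H) := by
      rw [← hfix z⁻¹, ← hz, inv_smul_smul]
    exact hq (hq1 ▸ hfix ⟨g ^ 2 ^ k, pow_mem (mem_zpowers g) _⟩)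
  have hcard : (MulAction.orbit (zpowers g) q).ncard = P := by
    rw [← Nat.card_coe_set_eq]
    exact (Nat.card_congr (MulAction.orbitZPowersEquiv g q)).trans (Nat.card_zmod _)
  calc 2 ^ (k + 1) ≤ 2 ^ j := Nat.pow_le_pow_right two_pos hkj
    _ = (MulAction.orbit (zpowers g) q).ncard := by rw [hcard, hj]
    _ < H.index := Set.ncard_lt_card fun h => hbase (h ▸ Set.mem_univ _)

open scoped Pointwise in
theorem isComplement'_of_disjoint_of_forall_eq_mul {X : Type*} [Group X] {G C : Subgroup X}
    (hdisj : Disjoint G C) (hfact : ∀ x : X, ∃ g ∈ G, ∃ y ∈ C, x = g * y) :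
    G.IsComplement' C := by
  refine isComplement'_of_disjoint_and_mul_eq_univ hdisj (Set.eq_univ_of_forall fun x => ?_)
  obtain ⟨g, hg, y, hy, rfl⟩ := hfact x
  exact Set.mul_mem_mul hg hy

/-- maximal class setup, `|G_X| = 2`: `m = n - 1`, i.e. the order
of `c` equals the order of `a`, namely `2^{n-1}`. -/
theorem core_order_two_gives_m_eq_of_maximal_class_setup
    {X : Type*} [Group X] [Finite X] (hX2 : IsPGroup 2 X)
    (n m : ℕ) (hn : 5 ≤ n)
    (a b c : X) (G C : Subgroup X)
    (hG : G = Subgroup.closure {a, b})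
    (hC : C = Subgroup.zpowers c)
    (hGcard : Nat.card G = 2 ^ n)
    (hCcard : Nat.card C = 2 ^ m)
    (ha : orderOf a = 2 ^ (n - 1))
    (hrel : (b ^ 2 = 1 ∧ b⁻¹ * a * b = a⁻¹) ∨
            (b ^ 2 = a ^ 2 ^ (n - 2) ∧ b⁻¹ * a * b = a⁻¹) ∨
            (b ^ 2 = 1 ∧ b⁻¹ * a * b = a ^ (2 ^ (n - 2) - 1)))
    (hfact : ∀ x : X, ∃ g ∈ G, ∃ y ∈ C, x = g * y)
    (hdisj : G ⊓ C = ⊥)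
    (hcore : C.normalCore = ⊥)
    (hGX2 : Nat.card G.normalCore = 2) :
    m = n - 1 ∧ orderOf c = orderOf a ∧ orderOf c = 2 ^ (n - 1) := by
  have hcompl := isComplement'_of_disjoint_of_forall_eq_mul (disjoint_iff.mpr hdisj) hfact
  have hCindex : C.index = 2 ^ n := by rw [hcompl.index_eq_card, hGcard]
  have hGindex : G.index = 2 ^ m := by rw [hcompl.symm.index_eq_card, hCcard]
  have hc : orderOf c = 2 ^ m := by rw [← Nat.card_zpowers, ← hC, hCcard]
  have hlower : 2 ^ (n - 3 + 1) < 2 ^ m := by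
    rw [← hGindex]
    refine two_pow_succ_lt_index_of_pow_notMem_normalCore hX2 G (g := a)
      (by rw [hG]; exact Subgroup.subset_closure (by simp)) (n - 3) fun hmem => ?_
    have hsq : (a ^ 2 ^ (n - 3)) ^ 2 = 1 := by
      have := pow_card_eq_one' (x := (⟨_, hmem⟩ : G.normalCore))
      rw [hGX2] at this
      exact congrArg Subtype.val this
    rw [← pow_mul, ← pow_succ] at hsq
    have hle := Nat.le_of_dvd (by positivity) (orderOf_dvd_of_pow_eq_one hsq)
    rw [ha, Nat.pow_le_pow_iff_right one_lt_two] at hle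
    omega
  have hlower' := (Nat.pow_lt_pow_iff_right one_lt_two).mp hlower
  have hupper : 2 ^ (m - 1 + 1) < 2 ^ n := by
    rw [← hCindex]
    refine two_pow_succ_lt_index_of_pow_notMem_normalCore hX2 C
      (hC ▸ mem_zpowers c) (m - 1) fun hmem => ?_
    rw [hcore, mem_bot] at hmem
    have hle := Nat.le_of_dvd (by positivity) (orderOf_dvd_of_pow_eq_one hmem)
    rw [hc, Nat.pow_le_pow_iff_right one_lt_two] at hle
    omega
  have hupper' := (Nat.pow_lt_pow_iff_right one_lt_two).mp hupper
  have hm : m = n - 1 := by omega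
  subst hm
  exact ⟨rfl, hc.trans ha.symm, hc⟩
end

section
/- Let p be a prime and let X be a finite group admitting a factorization X = GC, where G is a p-subgroup of X, C is a cyclic subgroup of X, G ∩ C = 1, and the core of C in X is trivial. Then O_{p'}(X) = 1, and consequently the Fitting subgroup F(X) equals O_p(X). -/
open Subgroup

/-- `O_p(X)`: the largest normal `p`-subgroup of `X`. -/
def pCore (p : ℕ) (X : Type*) [Group X] : Subgroup X :=
  sSup {H : Subgroup X | H.Normal ∧ IsPGroup p H}

/-- `O_{p'}(X)`: the largest normal subgroup of `X` of order coprime to `p`. -/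
def pPrimeCore (p : ℕ) (X : Type*) [Group X] : Subgroup X :=
  sSup {H : Subgroup X | H.Normal ∧ (Nat.card H).Coprime p}

/-- The Fitting subgroup: the largest nilpotent normal subgroup of `X`. -/
def fittingSubgroup (X : Type*) [Group X] : Subgroup X :=
  sSup {H : Subgroup X | H.Normal ∧ Group.IsNilpotent H}

/-- The relative index of `H` in a normal subgroup `N` of a finite group divides the index of `H`. -/
theorem Subgroup.relIndex_dvd_index_of_normal_right {X : Type*} [Group X] [Finite X]
    (H N : Subgroup X) [N.Normal] : H.relIndex N ∣ H.index := by
  have hH := relIndex_mul_relIndex ⊥ H (H ⊔ N) bot_le le_sup_left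
  have hN := relIndex_mul_relIndex ⊥ N (H ⊔ N) bot_le le_sup_right
  have hHi := relIndex_mul_relIndex ⊥ (N ⊓ H) H bot_le inf_le_right
  have hNi := relIndex_mul_relIndex ⊥ (H ⊓ N) N bot_le inf_le_right
  rw [relIndex_sup_right] at hN
  rw [inf_relIndex_right] at hHi hNi
  rw [inf_comm] at hHi
  simp only [relIndex_bot_left] at hH hN hHi hNi
  have hpos : 0 < Nat.card H := Nat.card_pos
  have heq : H.relIndex (H ⊔ N) = H.relIndex N := by
    apply Nat.eq_of_mul_eq_mul_left hpos
    rw [hH, ← hN, ← hNi, ← hHi]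
    ring
  exact heq ▸ relIndex_dvd_index_of_le le_sup_left

/-- A normal subgroup whose order is coprime to the index of `H` is contained in `H`. -/
theorem Subgroup.Normal.le_of_coprime_card_index {X : Type*} [Group X] [Finite X]
    {H N : Subgroup X} (hN : N.Normal) (h : (Nat.card N).Coprime H.index) : N ≤ H :=
  relIndex_eq_one.mp <| Nat.eq_one_of_dvd_coprimes h (relIndex_dvd_card H N)
    (relIndex_dvd_index_of_normal_right H N)

/-- If `O_{p'}(X) = 1` then every nilpotent normal subgroup of `X` is a `p`-group. -/
theorem Subgroup.Normal.isPGroup_of_pPrimeCore_eq_bot {p : ℕ} (hp : p.Prime) {X : Type*}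
    [Group X] [Finite X] (hX : pPrimeCore p X = ⊥) {H : Subgroup X} (hH : H.Normal)
    (hnil : Group.IsNilpotent H) : IsPGroup p H := by
  refine IsPGroup.of_card (Nat.eq_prime_pow_of_unique_prime_dvd Nat.card_pos.ne' ?_)
  intro q hq hqH
  by_contra hqp
  have : Fact q.Prime := ⟨hq⟩
  let P : Sylow q H := default
  have hP : (P : Subgroup H).Normal :=
    (Group.isNilpotent_of_finite_tfae.out 0 3 :
      Group.IsNilpotent H ↔ ∀ (q : ℕ) (_ : Fact q.Prime) (P : Sylow q H),
        (P : Subgroup H).Normal).mp hnil q this P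
  have := P.characteristic_of_normal hP
  have hcop : (Nat.card ((P : Subgroup H).map H.subtype)).Coprime p := by
    obtain ⟨n, hn⟩ := IsPGroup.iff_card.mp P.isPGroup'
    rw [card_map_of_injective H.subtype_injective, hn]
    exact Nat.Coprime.pow_left n ((Nat.coprime_primes hq hp).mpr hqp)
  have hle : (P : Subgroup H).map H.subtype ≤ pPrimeCore p X :=
    le_sSup ⟨inferInstance, hcop⟩
  rw [hX, le_bot_iff, map_eq_bot_iff_of_injective _ H.subtype_injective] at hle
  exact P.ne_bot_of_dvd_card hqH hle

/-- If `O_{p'}(X) = 1` then `F(X) = O_p(X)`. -/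
theorem fittingSubgroup_eq_pCore {p : ℕ} (hp : p.Prime) {X : Type*} [Group X] [Finite X]
    (hX : pPrimeCore p X = ⊥) : fittingSubgroup X = pCore p X := by
  have : Fact p.Prime := ⟨hp⟩
  refine congrArg sSup (Set.ext fun H => and_congr_right fun hH => ?_)
  exact ⟨hH.isPGroup_of_pPrimeCore_eq_bot hp hX, fun h => h.isNilpotent⟩

/-- if `X = GC` with `G` a `p`-subgroup, `C` cyclic, `G ⊓ C = 1` and `C`
core-free in `X`, then `O_{p'}(X) = 1` and consequently `F(X) = O_p(X)`. -/
theorem pPrimeCore_eq_bot_of_core_free_factorization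
    (p : ℕ) (hp : p.Prime) {X : Type*} [Group X] [Finite X]
    (G C : Subgroup X)
    (hGp : IsPGroup p G) (hCcyc : IsCyclic C)
    (hfact : ∀ x : X, ∃ g ∈ G, ∃ y ∈ C, x = g * y)
    (hdisj : G ⊓ C = ⊥) (hcore : C.normalCore = ⊥) :
    pPrimeCore p X = ⊥ ∧ fittingSubgroup X = pCore p X := by
  have : Fact p.Prime := ⟨hp⟩
  have hcompl : IsComplement' G C :=
    isComplement'_of_disjoint_and_mul_eq_univ (disjoint_iff.mpr hdisj) <|
      Set.eq_univ_of_forall fun x =>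
        let ⟨g, hg, y, hy, hx⟩ := hfact x
        ⟨g, hg, y, hy, hx.symm⟩
  have hX : pPrimeCore p X = ⊥ := by
    refine le_bot_iff.mp (sSup_le ?_)
    rintro N ⟨hN, hNp⟩
    obtain ⟨n, hn⟩ := IsPGroup.iff_card.mp hGp
    rw [← hcore]
    refine normal_le_normalCore.mpr (hN.le_of_coprime_card_index ?_)
    rw [hcompl.index_eq_card, hn]
    exact hNp.pow_right n
  exact ⟨hX, fittingSubgroup_eq_pCore hp hX⟩
end

section
/- Let X be a finite group admitting a factorization X = GC, where G and C = ⟨c⟩ are subgroups with G ∩ C = 1 and C cyclic. If g ∈ G and k is an integer such that g·c^k lies in the center Z(X), then g commutes with c and g lies in the core G_X of G in X. Consequently, if X is a nontrivial 2-group and the core of C in X is trivial, then G_X ≠ 1. -/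
open Subgroup

/-- if `X = GC` with `C = ⟨c⟩` cyclic and `G ⊓ C = 1`, then any
`g ∈ G` with `g·c^k ∈ Z(X)` commutes with `c` and lies in the core `G_X`;
consequently, if `X` is a nontrivial `2`-group and `C` is core-free in `X`,
then `G_X ≠ 1`. -/
theorem central_element_in_core_of_factorization
    {X : Type*} [Group X] [Finite X] (G C : Subgroup X) (c : X)
    (hC : C = Subgroup.zpowers c)
    (hfact : ∀ x : X, ∃ g ∈ G, ∃ y ∈ C, x = g * y)
    (hdisj : G ⊓ C = ⊥) :
    (∀ g ∈ G, ∀ k : ℤ, g * c ^ k ∈ Subgroup.center X →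
      Commute g c ∧ g ∈ G.normalCore) ∧
    (Nontrivial X → IsPGroup 2 X → C.normalCore = ⊥ → G.normalCore ≠ ⊥) := by
  have core : ∀ g ∈ G, ∀ k : ℤ, g * c ^ k ∈ Subgroup.center X →
      Commute g c ∧ g ∈ G.normalCore := by
    intro g hg k hz
    have hgc : Commute g c := by
      have h : Commute (g * c ^ k * (c ^ k)⁻¹) c :=
        Commute.mul_left (Subgroup.mem_center_iff.mp hz c).symm
          ((Commute.refl c).zpow_left k).inv_left
      rwa [mul_inv_cancel_right] at h
    refine ⟨hgc, fun x => ?_⟩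
    obtain ⟨h, hh, y, hy, rfl⟩ := hfact x
    rw [hC] at hy
    obtain ⟨m, rfl⟩ := Subgroup.mem_zpowers_iff.mp hy
    have hconj : h * c ^ m * g * (h * c ^ m)⁻¹ = h * g * h⁻¹ := by
      rw [mul_assoc h, ← (hgc.zpow_right m).eq]
      group
    rw [hconj]
    exact G.mul_mem (G.mul_mem hh hg) (G.inv_mem hh)
  refine ⟨core, fun _ hX hCcore hGcore => ?_⟩
  have := hX.center_nontrivial
  obtain ⟨z, hz, hz1⟩ := (Subgroup.nontrivial_iff_exists_ne_one _).mp this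
  obtain ⟨g, hg, y, hy, rfl⟩ := hfact z
  obtain ⟨k, rfl⟩ := Subgroup.mem_zpowers_iff.mp (hC ▸ hy)
  have hg1 : g = 1 := by
    simpa [hGcore] using (core g hg k hz).2
  rw [hg1, one_mul] at hz hz1
  have hmem : c ^ k ∈ C.normalCore := fun x => by
    rwa [Subgroup.mem_center_iff.mp hz x, mul_inv_cancel_right]
  exact hz1 (by simpa [hCcore] using hmem)
end

section
/- There exists a finite group X with subgroups G and C such that G is isomorphic to the dihedral group of order 8, C is cyclic of order 3, X = GC, G ∩ C = 1, and the core of C in X is trivial. Likewise there exists a finite group Y with subgroups H and D such that H is isomorphic to the Klein four-group (the dihedral group of order 4), D is cyclic of order 3, Y = HD, H ∩ D = 1, and the core of D in Y is trivial. (Hence the conclusion of the theorem 'X = GC with G of maximal class, C cyclic core-free, G ∩ C = 1 and |G| ≥ 32 implies X is a 2-group' fails for dihedral groups of order 4 and 8.) -/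
open Subgroup

/-- A subgroup of prime order generated by an element that does not commute with one of its
conjugates is core-free. -/
theorem normalCore_zpowers_eq_bot {X : Type*} [Group X] {c g : X} (hc : (orderOf c).Prime)
    (hg : ¬ Commute (g * c * g⁻¹) c) : (zpowers c).normalCore = ⊥ := by
  have : Fact (Nat.card (zpowers c)).Prime := ⟨by rwa [Nat.card_zpowers]⟩
  have hle := normalCore_le (zpowers c)
  rcases ((zpowers c).normalCore.subgroupOf (zpowers c)).eq_bot_or_eq_top_of_prime_card with h | h
  · rwa [subgroupOf_eq_bot, disjoint_of_le_iff_left_eq_bot hle] at h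
  · have hmem : c ∈ (zpowers c).normalCore := subgroupOf_eq_top.1 h (mem_zpowers c)
    obtain ⟨k, hk⟩ := mem_zpowers_iff.1 (hle ((normalCore_normal _).conj_mem c hmem g))
    exact absurd (hk ▸ (Commute.refl c).zpow_left k) hg

/-- A dihedral subgroup and an element of order three with non-commuting conjugates give a
factorization with core-free cyclic factor, as soon as the orders match. -/
theorem exists_factorization_of_dihedral {X : Type*} [Group X] [Finite X] {n : ℕ}
    (f : DihedralGroup n →* X) (hf : Function.Injective f) {c g : X} (hc : orderOf c = 3)
    (hg : ¬ Commute (g * c * g⁻¹) c) (hcard : 2 * n * 3 = Nat.card X)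
    (hcop : (2 * n).Coprime 3) :
    ∃ G C : Subgroup X, Nonempty (G ≃* DihedralGroup n) ∧ IsCyclic C ∧ Nat.card C = 3 ∧
      (∀ x : X, ∃ g ∈ G, ∃ y ∈ C, x = g * y) ∧ G ⊓ C = ⊥ ∧ C.normalCore = ⊥ := by
  have e := MonoidHom.ofInjective hf
  have hG : Nat.card f.range = 2 * n := by
    rw [← DihedralGroup.nat_card, Nat.card_congr e.toEquiv]
  have hC : Nat.card (zpowers c) = 3 := by rw [Nat.card_zpowers, hc]
  have hcompl : IsComplement' f.range (zpowers c) :=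
    isComplement'_of_coprime (by rw [hG, hC, hcard]) (by rwa [hG, hC])
  refine ⟨f.range, zpowers c, ⟨e.symm⟩, inferInstance, hC, fun x ↦ ?_,
    hcompl.disjoint.eq_bot, normalCore_zpowers_eq_bot (by rw [hc]; norm_num) hg⟩
  obtain ⟨⟨a, b⟩, rfl⟩ := hcompl.surjective x
  exact ⟨a, a.2, b, b.2, rfl⟩

/-- The symmetries of a square, acting on its vertices. -/
def squareSymmetries : DihedralGroup 4 →* Equiv.Perm (Fin 4) :=
  MonoidHom.mk' (fun
    | .r i => finRotate 4 ^ i.val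
    | .sr i => Equiv.swap 1 3 * finRotate 4 ^ i.val) (by decide)

open Equiv Equiv.Perm in
/-- The embedding of the Klein four-group in the alternating group of degree four. -/
def kleinFour : DihedralGroup 2 →* alternatingGroup (Fin 4) :=
  MonoidHom.mk' (fun
    | .r i => ⟨swap 0 1 * swap 2 3, mem_alternatingGroup.2 (by decide)⟩ ^ i.val
    | .sr i => ⟨swap 0 2 * swap 1 3, mem_alternatingGroup.2 (by decide)⟩ *
        ⟨swap 0 1 * swap 2 3, mem_alternatingGroup.2 (by decide)⟩ ^ i.val) (by decide)

/-- there are finite groups `X = GC` with `G ≅ D₈` (dihedral of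
order 8), `C` cyclic of order 3, `G ⊓ C = 1` and `C` core-free, and `Y = HD` with
`H` the Klein four-group, `D` cyclic of order 3, `H ⊓ D = 1` and `D` core-free.
(Here `DihedralGroup k` has order `2k`.) -/
theorem exists_core_free_cyclic_factor_dihedral_small :
    (∃ (X : Type) (_ : Group X) (_ : Finite X) (G C : Subgroup X),
      Nonempty (G ≃* DihedralGroup 4) ∧ IsCyclic C ∧ Nat.card C = 3 ∧
      (∀ x : X, ∃ g ∈ G, ∃ y ∈ C, x = g * y) ∧
      G ⊓ C = ⊥ ∧ C.normalCore = ⊥) ∧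
    (∃ (Y : Type) (_ : Group Y) (_ : Finite Y) (H D : Subgroup Y),
      Nonempty (H ≃* DihedralGroup 2) ∧ IsCyclic D ∧ Nat.card D = 3 ∧
      (∀ y : Y, ∃ h ∈ H, ∃ d ∈ D, y = h * d) ∧
      H ⊓ D = ⊥ ∧ D.normalCore = ⊥) := by
  constructor
  · refine ⟨Equiv.Perm (Fin 4), inferInstance, inferInstance,
      exists_factorization_of_dihedral squareSymmetries (by decide)
        (c := Equiv.swap 0 1 * Equiv.swap 1 2) (g := Equiv.swap 0 3)
        (orderOf_eq_prime (by decide) (by decide)) (by unfold Commute SemiconjBy; decide)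
        ?_ (by decide)⟩
    rw [Nat.card_perm, Nat.card_fin]
    rfl
  · refine ⟨alternatingGroup (Fin 4), inferInstance, inferInstance,
      exists_factorization_of_dihedral kleinFour (by decide)
        (c := ⟨Equiv.swap 0 1 * Equiv.swap 1 2, Equiv.Perm.mem_alternatingGroup.2 (by decide)⟩)
        (g := ⟨Equiv.swap 0 1 * Equiv.swap 2 3, Equiv.Perm.mem_alternatingGroup.2 (by decide)⟩)
        (orderOf_eq_prime (by decide) (by decide)) (by unfold Commute SemiconjBy; decide)
        ?_ (by decide)⟩
    rw [nat_card_alternatingGroup, Nat.card_fin]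
    rfl
end
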